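/- arXiv:2205.02819 — 5 statements merged into one kernel-verified Lean document; each statement's English description precedes it below -/
import Mathlib

section
/- Let S be a finite set of natural numbers with 0 ∈ S and S ≠ {0}. Let M denote the maximum of S and let q denote the minimum of S \ {0}. Assume: (a) for every i ∈ S one has M − i ∈ S, and (b) for all x, y ∈ S with x + y ≤ M one has x + y ∈ S. Then for every natural number s, s ∈ S if and only if q divides s and s ≤ M; in particular q divides M. -/
/-- A finite set `S ⊆ ℕ` with `0 ∈ S`, `S ≠ {0}`, which is symmetric about
its maximum `M` and closed under addition within range `M`, is exactly the arithmetic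
progression `{0, q, 2q, …, M}` where `q = min (S \ {0})`; in particular `q ∣ M`. -/
theorem stmt_0 (S : Finset ℕ) (h0 : (0 : ℕ) ∈ S) (hne : S ≠ {0})
    (M q : ℕ) (hM : IsGreatest (S : Set ℕ) M) (hq : IsLeast ((S : Set ℕ) \ {0}) q)
    (ha : ∀ i ∈ S, M - i ∈ S)
    (hb : ∀ x ∈ S, ∀ y ∈ S, x + y ≤ M → x + y ∈ S) :
    (∀ s : ℕ, s ∈ S ↔ q ∣ s ∧ s ≤ M) ∧ q ∣ M := by
  obtain ⟨⟨hqS, hq0⟩, hqmin⟩ := hq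
  have hqpos : 0 < q := Nat.pos_of_ne_zero hq0
  have hle : ∀ s ∈ S, s ≤ M := fun s hs => hM.2 hs
  have hsub : ∀ s ∈ S, q ≤ s → s - q ∈ S := by
    intro s hs hqs
    have hsM := hle s hs
    have h := ha _ (hb (M - s) (ha s hs) q hqS (by omega))
    rwa [show M - (M - s + q) = s - q by omega] at h
  have hdvd : ∀ s, s ∈ S → q ∣ s := by
    intro s
    induction s using Nat.strong_induction_on with
    | _ s ih =>
      intro hs
      rcases Nat.eq_zero_or_pos s with rfl | hspos
      · exact dvd_zero q
      · have hqs : q ≤ s := hqmin ⟨hs, hspos.ne'⟩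
        have h := dvd_add (ih (s - q) (by omega) (hsub s hs hqs)) (dvd_refl q)
        rwa [Nat.sub_add_cancel hqs] at h
  have hmul : ∀ k, q * k ≤ M → q * k ∈ S := by
    intro k
    induction k with
    | zero => simpa using h0
    | succ k ih =>
      intro hk
      rw [Nat.mul_succ] at hk ⊢
      exact hb _ (ih (by omega)) q hqS hk
  refine ⟨fun s => ⟨fun hs => ⟨hdvd s hs, hle s hs⟩, ?_⟩, hdvd M hM.1⟩
  rintro ⟨⟨k, rfl⟩, hk⟩
  exact hmul k hk
end

section
/- Let S be a finite set of natural numbers with 0 ∈ S and S ≠ {0}. Let M denote the maximum of S and let q denote the minimum of S \ {0}. Assume: (a) for every i ∈ S one has M − i ∈ S, and (b) for all x, y ∈ S with x + y ≤ M one has x + y ∈ S. Then in the polynomial ring ℤ[X] one has (Σ_{i ∈ S} X^i) · (X^q − 1) = X^{M+q} − 1. -/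
open Polynomial

/-- If `S` is symmetric about its maximum `M` and closed under addition within range `M`, then
translating `S` by its least nonzero element `q` trades the element `0` for `M + q`. -/
theorem insert_zero_image_add_eq_insert (S : Finset ℕ) (h0 : (0 : ℕ) ∈ S)
    (M q : ℕ) (hM : IsGreatest (S : Set ℕ) M) (hq : IsLeast ((S : Set ℕ) \ {0}) q)
    (ha : ∀ i ∈ S, M - i ∈ S)
    (hb : ∀ x ∈ S, ∀ y ∈ S, x + y ≤ M → x + y ∈ S) :
    insert 0 (S.image (· + q)) = insert (M + q) S := by
  have hle : ∀ x ∈ S, x ≤ M := fun x hx => hM.2 hx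
  have hqS : q ∈ S := hq.1.1
  have hmin : ∀ x ∈ S, x ≠ 0 → q ≤ x := fun x hx hx0 => hq.2 ⟨hx, hx0⟩
  ext x
  simp only [Finset.mem_insert, Finset.mem_image]
  constructor
  · rintro (rfl | ⟨y, hy, rfl⟩)
    · exact Or.inr h0
    · by_cases hyq : y + q ≤ M
      · exact Or.inr (hb y hy q hqS hyq)
      · have := hle y hy
        have := hmin (M - y) (ha y hy)
        left
        lia
  · rintro (rfl | hx)
    · exact Or.inr ⟨M, hM.1, rfl⟩
    · by_cases hx0 : x = 0
      · exact Or.inl hx0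
      · have hqx := hmin x hx hx0
        have hxM := hle x hx
        have h := ha _ (hb (M - x) (ha x hx) q hqS (by lia))
        rw [show M - (M - x + q) = x - q by lia] at h
        exact Or.inr ⟨x - q, h, by lia⟩

/-- For a finite set `S ⊆ ℕ` with `0 ∈ S`, `S ≠ {0}`, symmetric about its
maximum `M` and closed under addition within range `M`, the generating polynomial of `S`
satisfies `(Σ_{i∈S} X^i) · (X^q − 1) = X^{M+q} − 1` in `ℤ[X]`, where `q = min (S \ {0})`. -/
theorem stmt_1 (S : Finset ℕ) (h0 : (0 : ℕ) ∈ S) (hne : S ≠ {0})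
    (M q : ℕ) (hM : IsGreatest (S : Set ℕ) M) (hq : IsLeast ((S : Set ℕ) \ {0}) q)
    (ha : ∀ i ∈ S, M - i ∈ S)
    (hb : ∀ x ∈ S, ∀ y ∈ S, x + y ≤ M → x + y ∈ S) :
    (∑ i ∈ S, (X : ℤ[X]) ^ i) * (X ^ q - 1) = X ^ (M + q) - 1 := by
  have hq0 : q ≠ 0 := hq.1.2
  have hMq : M + q ∉ S := fun h => by
    have : M + q ≤ M := hM.2 h
    lia
  have h0q : 0 ∉ S.image (· + q) := by simp [hq0]
  have h := congrArg (fun T : Finset ℕ => ∑ i ∈ T, (X : ℤ[X]) ^ i)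
    (insert_zero_image_add_eq_insert S h0 M q hM hq ha hb)
  simp only [Finset.sum_insert hMq, Finset.sum_insert h0q,
    Finset.sum_image (add_left_injective q).injOn, pow_add, ← Finset.sum_mul, pow_zero] at h
  rw [pow_add]
  linear_combination h
end

section
/- Let p be a prime number, let s and r be natural numbers, and set n = p^s. Let d, j, j' : Fin r → ℕ be families such that for every i the number d i is positive and coprime to p, and j' i ≤ j i. Suppose there exists a polynomial F ∈ ℤ[X] such that in ℤ[X] one has (X^n − 1) · ∏_{i} (X^{d i · p^{j' i}} − 1) = (X − 1) · ∏_{i} (X^{d i · p^{j i}} − 1) · F. Then j i = j' i for every index i with d i > 1. -/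
open Polynomial

/-- At a primitive `m`-th root of unity, `X ^ k - 1` has a simple root if `m ∣ k`, and no root
otherwise. -/
theorem IsPrimitiveRoot.count_roots_X_pow_sub_one {K : Type*} [Field K] [CharZero K]
    [DecidableEq K] {ζ : K} {m k : ℕ} (hζ : IsPrimitiveRoot ζ m) (hk : 0 < k) :
    ((X : K[X]) ^ k - 1).roots.count ζ = if m ∣ k then 1 else 0 := by
  have hne : (X : K[X]) ^ k - 1 ≠ 0 := X_pow_sub_C_ne_zero hk (1 : K)
  have hmem : ζ ∈ ((X : K[X]) ^ k - 1).roots ↔ m ∣ k := by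
    rw [mem_roots hne, IsRoot.def, eval_sub, eval_pow, eval_X, eval_one, sub_eq_zero,
      hζ.pow_eq_one_iff_dvd]
  have hsep : ((X : K[X]) ^ k - 1).Separable :=
    X_pow_sub_one_separable_iff.mpr (Nat.cast_ne_zero.mpr hk.ne')
  rw [Multiset.count_eq_of_nodup (nodup_roots hsep)]
  simp only [hmem]

theorem IsPrimitiveRoot.count_roots_prod_X_pow_sub_one {K ι : Type*} [Field K] [CharZero K]
    [DecidableEq K] {ζ : K} {m : ℕ} (hζ : IsPrimitiveRoot ζ m) (t : Finset ι) (e : ι → ℕ)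
    (he : ∀ i ∈ t, 0 < e i) :
    (∏ i ∈ t, ((X : K[X]) ^ e i - 1)).roots.count ζ = (t.filter fun i => m ∣ e i).card := by
  have hne : ∏ i ∈ t, ((X : K[X]) ^ e i - 1) ≠ 0 :=
    Finset.prod_ne_zero_iff.mpr fun i hi => X_pow_sub_C_ne_zero (he i hi) (1 : K)
  rw [roots_prod _ _ hne, Multiset.count_bind, Finset.card_filter]
  exact Finset.sum_congr rfl fun i hi => hζ.count_roots_X_pow_sub_one (he i hi)

/-- If `m` does not divide `n` and `(X ^ n - 1) * ∏ (X ^ b i - 1)` is a multiple of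
`∏ (X ^ a i - 1)`, then at most as many `a i` as `b i` are divisible by `m`. -/
theorem card_filter_dvd_le_of_prod_X_pow_sub_one_dvd {ι : Type*} (t : Finset ι) {a b : ι → ℕ}
    {n m : ℕ} (hn : 0 < n) (hm : 0 < m) (hmn : ¬ m ∣ n) (ha : ∀ i ∈ t, 0 < a i)
    (hb : ∀ i ∈ t, 0 < b i)
    (h : ∏ i ∈ t, ((X : ℤ[X]) ^ a i - 1) ∣ (X ^ n - 1) * ∏ i ∈ t, ((X : ℤ[X]) ^ b i - 1)) :
    (t.filter fun i => m ∣ a i).card ≤ (t.filter fun i => m ∣ b i).card := by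
  classical
  have hζ := Complex.isPrimitiveRoot_exp m hm.ne'
  have hdvd := map_dvd (mapRingHom (Int.castRingHom ℂ)) h
  simp only [map_mul, map_prod, map_sub, map_pow, map_one, coe_mapRingHom, map_X] at hdvd
  have hne : ((X : ℂ[X]) ^ n - 1) * ∏ i ∈ t, ((X : ℂ[X]) ^ b i - 1) ≠ 0 :=
    mul_ne_zero (X_pow_sub_C_ne_zero hn (1 : ℂ))
      (Finset.prod_ne_zero_iff.mpr fun i hi => X_pow_sub_C_ne_zero (hb i hi) (1 : ℂ))
  have hle := Multiset.count_le_of_le (Complex.exp (2 * Real.pi * Complex.I / m))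
    (roots.le_of_dvd hne hdvd)
  rwa [roots_mul hne, Multiset.count_add, hζ.count_roots_X_pow_sub_one hn, if_neg hmn, zero_add,
    hζ.count_roots_prod_X_pow_sub_one t a ha, hζ.count_roots_prod_X_pow_sub_one t b hb] at hle

/-- If `n = p^s` and `(X^n − 1) · ∏ᵢ (X^{dᵢ p^{j'ᵢ}} − 1)
= (X − 1) · ∏ᵢ (X^{dᵢ p^{jᵢ}} − 1) · F` in `ℤ[X]`, with each `dᵢ` positive and coprime
to the prime `p`, and `j'ᵢ ≤ jᵢ`, then `jᵢ = j'ᵢ` for every `i` with `dᵢ > 1`. -/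
theorem stmt_2 (p : ℕ) (hp : p.Prime) (s r : ℕ) (n : ℕ) (hn : n = p ^ s)
    (d j j' : Fin r → ℕ)
    (hd : ∀ i, 0 < d i ∧ Nat.Coprime (d i) p)
    (hjj : ∀ i, j' i ≤ j i)
    (hF : ∃ F : ℤ[X],
      ((X : ℤ[X]) ^ n - 1) * ∏ i, ((X : ℤ[X]) ^ (d i * p ^ j' i) - 1) =
        ((X : ℤ[X]) - 1) * (∏ i, ((X : ℤ[X]) ^ (d i * p ^ j i) - 1)) * F) :
    ∀ i, 1 < d i → j i = j' i := by
  obtain ⟨F, hF⟩ := hF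
  intro i hi
  have hpos (e : Fin r → ℕ) (k : Fin r) : 0 < d k * p ^ e k :=
    Nat.mul_pos (hd k).1 (pow_pos hp.pos _)
  have hndvd : ¬ d i * p ^ j i ∣ n := fun h =>
    hi.ne' (((hd i).2.pow_right s).eq_one_of_dvd (hn ▸ (dvd_mul_right _ _).trans h))
  have hle := card_filter_dvd_le_of_prod_X_pow_sub_one_dvd Finset.univ
    (hn ▸ pow_pos hp.pos s) (hpos j i) hndvd (fun k _ => hpos j k) (fun k _ => hpos j' k)
    (hF ▸ (dvd_mul_left _ _).mul_right F)
  have hsub : (Finset.univ.filter fun k => d i * p ^ j i ∣ d k * p ^ j' k) ⊆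
      Finset.univ.filter fun k => d i * p ^ j i ∣ d k * p ^ j k :=
    Finset.monotone_filter_right _ fun k _ h =>
      h.trans (mul_dvd_mul_left _ (pow_dvd_pow p (hjj k)))
  have hmem : i ∈ Finset.univ.filter fun k => d i * p ^ j i ∣ d k * p ^ j' k := by
    rw [Finset.eq_of_subset_of_card_le hsub hle]
    simp
  have hdvd := Nat.dvd_of_mul_dvd_mul_left (hd i).1 (Finset.mem_filter.mp hmem).2
  exact le_antisymm ((Nat.pow_dvd_pow_iff_le_right hp.one_lt).mp hdvd) (hjj i)
end

section
/- Let A and B be finite multisets of positive natural numbers. If ∏_{a ∈ A} (X^a − 1) = ∏_{b ∈ B} (X^b − 1) in the polynomial ring ℤ[X], then A = B as multisets. -/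
open Polynomial

/-- If `∏_{a∈A} (X^a − 1) = ∏_{b∈B} (X^b − 1)`, then every `m ∈ A` divides some `b ∈ B`. -/
theorem exists_dvd_of_prod_X_pow_sub_one_eq {A B : Multiset ℕ} {m : ℕ} (hm : m ≠ 0) (hmA : m ∈ A)
    (h : (A.map fun a => (X : ℤ[X]) ^ a - 1).prod = (B.map fun b => (X : ℤ[X]) ^ b - 1).prod) :
    ∃ b ∈ B, m ∣ b := by
  have hζ := Complex.isPrimitiveRoot_exp m hm
  have hdvd : (X : ℤ[X]) ^ m - 1 ∣ (B.map fun b => (X : ℤ[X]) ^ b - 1).prod :=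
    h ▸ Multiset.dvd_prod (Multiset.mem_map_of_mem _ hmA)
  have hroot := map_dvd (aeval (Complex.exp (2 * Real.pi * Complex.I / m))) hdvd
  rw [map_sub, map_pow, aeval_X, map_one, hζ.pow_eq_one, sub_self, zero_dvd_iff,
    map_multiset_prod, Multiset.prod_eq_zero_iff, Multiset.map_map, Multiset.mem_map] at hroot
  obtain ⟨b, hb, hb0⟩ := hroot
  refine ⟨b, hb, hζ.dvd_of_pow_eq_one b ?_⟩
  simpa [sub_eq_zero] using hb0

/-- Finite multisets `A`, `B` of positive natural numbers with
`∏_{a∈A} (X^a − 1) = ∏_{b∈B} (X^b − 1)` in `ℤ[X]` are equal. -/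
theorem stmt_3 (A B : Multiset ℕ) (hA : ∀ a ∈ A, 0 < a) (hB : ∀ b ∈ B, 0 < b)
    (h : (A.map fun a => (X : ℤ[X]) ^ a - 1).prod = (B.map fun b => (X : ℤ[X]) ^ b - 1).prod) :
    A = B := by
  induction hn : A.card using Nat.strong_induction_on generalizing A B with
  | _ n ih =>
  by_cases hAB : (A + B).toFinset.Nonempty
  · obtain ⟨m, hm, hmax⟩ := (A + B).toFinset.exists_max_image id hAB
    simp only [Multiset.mem_toFinset, Multiset.mem_add, id] at hm hmax
    have hm0 : 0 < m := hm.elim (hA m) (hB m)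
    have hmAB : m ∈ A ∧ m ∈ B := by
      rcases hm with hm | hm
      · obtain ⟨b, hb, hmb⟩ := exists_dvd_of_prod_X_pow_sub_one_eq hm0.ne' hm h
        have := (hmax b (.inr hb)).antisymm (Nat.le_of_dvd (hB b hb) hmb)
        exact ⟨hm, this ▸ hb⟩
      · obtain ⟨a, ha, hma⟩ := exists_dvd_of_prod_X_pow_sub_one_eq hm0.ne' hm h.symm
        have := (hmax a (.inl ha)).antisymm (Nat.le_of_dvd (hA a ha) hma)
        exact ⟨this ▸ ha, hm⟩
    obtain ⟨A, rfl⟩ := Multiset.exists_cons_of_mem hmAB.1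
    obtain ⟨B, rfl⟩ := Multiset.exists_cons_of_mem hmAB.2
    rw [Multiset.map_cons, Multiset.map_cons, Multiset.prod_cons, Multiset.prod_cons] at h
    have hne : (X : ℤ[X]) ^ m - 1 ≠ 0 := (monic_X_pow_sub_C 1 hm0.ne').ne_zero
    rw [ih A.card (by simp [← hn]) A B (fun a ha => hA a (Multiset.mem_cons_of_mem ha))
      (fun b hb => hB b (Multiset.mem_cons_of_mem hb)) (mul_left_cancel₀ hne h) rfl]
  · rw [Finset.not_nonempty_iff_eq_empty, Multiset.toFinset_eq_empty, add_eq_zero] at hAB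
    rw [hAB.1, hAB.2]
end

section
/- Let q and r be natural numbers with q ≥ 1, and let a, b : Fin r → ℕ be families of positive natural numbers. If in the polynomial ring ℤ[X] one has (X^q − 1) · ∏_{i} (X^{a i} − 1) = (X − 1) · ∏_{i} (X^{b i} − 1), then the multiset {q} + {a i : i ∈ Fin r} equals the multiset {1} + {b i : i ∈ Fin r}. -/
open Polynomial

/-- If a product of factors `X ^ n - 1` with `0 < n ≤ m` is divisible by `X ^ m - 1`, then
`X ^ m - 1` is one of the factors. -/
lemma mem_of_X_pow_sub_one_dvd_prod {m : ℕ} (hm : 0 < m) {T : Multiset ℕ}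
    (hpos : ∀ n ∈ T, 0 < n) (hle : ∀ n ∈ T, n ≤ m)
    (h : (X : ℤ[X]) ^ m - 1 ∣ (T.map fun n => (X : ℤ[X]) ^ n - 1).prod) : m ∈ T := by
  have hζ := Complex.isPrimitiveRoot_exp m hm.ne'
  set ζ := Complex.exp (2 * Real.pi * Complex.I / m)
  have h0 : (aeval ζ) (T.map fun n => (X : ℤ[X]) ^ n - 1).prod = 0 := by
    obtain ⟨c, hc⟩ := h
    simp [hc, hζ.pow_eq_one]
  rw [map_multiset_prod, Multiset.map_map, Multiset.prod_eq_zero_iff, Multiset.mem_map] at h0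
  obtain ⟨n, hn, hn0⟩ := h0
  have hdvd : m ∣ n := hζ.dvd_of_pow_eq_one n (by simpa [sub_eq_zero] using hn0)
  rwa [(Nat.le_of_dvd (hpos n hn) hdvd).antisymm (hle n hn)]

/-- A multiset of positive exponents is determined by the product of the `X ^ n - 1`. -/
lemma eq_of_prod_X_pow_sub_one_eq {S T : Multiset ℕ} (hS : ∀ n ∈ S, 0 < n)
    (hT : ∀ n ∈ T, 0 < n)
    (h : (S.map fun n => (X : ℤ[X]) ^ n - 1).prod = (T.map fun n => (X : ℤ[X]) ^ n - 1).prod) :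
    S = T := by
  induction hc : S.card generalizing S T with
  | zero =>
    obtain rfl := Multiset.card_eq_zero.mp hc
    refine (Multiset.eq_zero_of_forall_notMem fun n hn => ?_).symm
    have h1 := congrArg (eval 1) (h.trans (Multiset.prod_map_erase hn).symm)
    simp at h1
  | succ k ih =>
    obtain ⟨m, hm, hmax⟩ : ∃ m ∈ S + T, ∀ n ∈ S + T, n ≤ m := by
      obtain ⟨s, hs⟩ := Multiset.card_pos_iff_exists_mem.mp (show 0 < S.card by lia)
      obtain ⟨m, hm, hmax⟩ := (S + T).toFinset.exists_max_image id ⟨s, by simp [hs]⟩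
      exact ⟨m, Multiset.mem_toFinset.mp hm, fun n hn => hmax n (Multiset.mem_toFinset.mpr hn)⟩
    have hSle : ∀ n ∈ S, n ≤ m := fun n hn => hmax n (Multiset.mem_add.mpr (.inl hn))
    have hTle : ∀ n ∈ T, n ≤ m := fun n hn => hmax n (Multiset.mem_add.mpr (.inr hn))
    have hdvd : ∀ {U : Multiset ℕ}, m ∈ U →
        (X : ℤ[X]) ^ m - 1 ∣ (U.map fun n => (X : ℤ[X]) ^ n - 1).prod :=
      fun hU => Multiset.dvd_prod (Multiset.mem_map_of_mem _ hU)
    have hmem : m ∈ S ∧ m ∈ T := by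
      rcases Multiset.mem_add.mp hm with hm | hm
      · exact ⟨hm, mem_of_X_pow_sub_one_dvd_prod (hS m hm) hT hTle (h ▸ hdvd hm)⟩
      · exact ⟨mem_of_X_pow_sub_one_dvd_prod (hT m hm) hS hSle (h ▸ hdvd hm), hm⟩
    obtain ⟨hmS, hmT⟩ := hmem
    rw [← Multiset.prod_map_erase hmS, ← Multiset.prod_map_erase hmT] at h
    have hne : (X : ℤ[X]) ^ m - 1 ≠ 0 := (monic_X_pow_sub_C 1 (hS m hmS).ne').ne_zero
    rw [← Multiset.cons_erase hmS, ← Multiset.cons_erase hmT,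
      ih (fun n hn => hS n (Multiset.mem_of_mem_erase hn))
        (fun n hn => hT n (Multiset.mem_of_mem_erase hn)) (mul_left_cancel₀ hne h)
        (by rw [Multiset.card_erase_of_mem hmS, hc, Nat.pred_succ])]

/-- If `q ≥ 1`, all `a i`, `b i` are positive, and
`(X^q − 1) · ∏ᵢ (X^{a i} − 1) = (X − 1) · ∏ᵢ (X^{b i} − 1)` in `ℤ[X]`, then the multiset
`{q} + {a i}` equals the multiset `{1} + {b i}`. -/
theorem stmt_4 (q r : ℕ) (hq : 1 ≤ q) (a b : Fin r → ℕ)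
    (ha : ∀ i, 0 < a i) (hb : ∀ i, 0 < b i)
    (h : ((X : ℤ[X]) ^ q - 1) * ∏ i, ((X : ℤ[X]) ^ a i - 1) =
        ((X : ℤ[X]) - 1) * ∏ i, ((X : ℤ[X]) ^ b i - 1)) :
    q ::ₘ Multiset.map a Finset.univ.val = 1 ::ₘ Multiset.map b Finset.univ.val := by
  refine eq_of_prod_X_pow_sub_one_eq ?_ ?_ ?_
  · simpa using ⟨hq, ha⟩
  · simpa using hb
  · simpa [Finset.prod, Function.comp_def] using h
end
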